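/- Suppose for each n ∈ ℕ, (ζ^n, ψ^n) ∈ C_T and φ^n ∈ S_T(ζ^n, ψ^n). For k ≥ 0 and t ∈ [0,T] let B^n_k(t) := ∫_{[0,t]×[0,1]} 1_{[0, r_k(ζ^n(s)))}(y)·φ^n_k(s,y) ds dy, and for K ≥ 1 define U_K := sup_n ∑_{k≥K} ∫_{[0,T]×[0,1]} k·φ^n_k(s,y)·1_{[0, r_k(ζ^n(s)))}(y) ds dy. Then U_K < ∞ for each K, and as K → ∞ all three of the quantities U_K, sup_n ∑_{k≥K} k·sup_{0≤t≤T}|B^n_k(t)|, and sup_n ∑_{k≥K} k·sup_{0≤t≤T} ζ^n_k(t) converge to 0; in fact each is bounded above by ∑_{k≥K} k·p_k. -/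

import Mathlib

open MeasureTheory Filter Topology
open scoped ENNReal

noncomputable def ell (x : ℝ) : ℝ := x * Real.log x - x + 1

noncomputable def rtot (x : ℕ → ℝ) : ℝ := max (x 0) 0 + ∑' k : ℕ, (k : ℝ) * x k

noncomputable def rcoord (x : ℕ → ℝ) (k : ℕ) : ℝ :=
  if 0 < rtot x then (if k = 0 then max (x 0) 0 else (k : ℝ) * x k) / rtot x else 0

noncomputable def skorokhod (ψ : ℝ → ℝ) (t : ℝ) : ℝ :=
  ψ t - min (sInf (ψ '' Set.Icc 0 t)) 0

def AbsCont (f : ℝ → ℝ) (a b : ℝ) : Prop :=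
  ∀ ε > 0, ∃ δ > 0, ∀ n : ℕ, ∀ I : Fin n → ℝ × ℝ,
    (∀ i, (I i).1 ∈ Set.Icc a b ∧ (I i).2 ∈ Set.Icc a b ∧ (I i).1 ≤ (I i).2) →
    (∀ i j, i ≠ j → Disjoint (Set.Ioo (I i).1 (I i).2) (Set.Ioo (I j).1 (I j).2)) →
    (∑ i, ((I i).2 - (I i).1)) < δ →
    (∑ i, |f (I i).2 - f (I i).1|) < ε

def memCT (T : ℝ) (p : ℕ → ℝ) (ζ : ℕ → ℝ → ℝ) (ψ : ℝ → ℝ) : Prop :=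
  (∀ k, ContinuousOn (ζ k) (Set.Icc 0 T)) ∧
  ContinuousOn ψ (Set.Icc 0 T) ∧
  ψ 0 = 0 ∧ AbsCont ψ 0 T ∧
  (∀ t ∈ Set.Icc (0:ℝ) T, ζ 0 t = skorokhod ψ t) ∧
  (∀ k : ℕ, 1 ≤ k →
    ζ k 0 = p k ∧ (∀ t ∈ Set.Icc (0:ℝ) T, 0 ≤ ζ k t) ∧
    AntitoneOn (ζ k) (Set.Icc 0 T) ∧ AbsCont (ζ k) 0 T)

noncomputable def Bint (ζ : ℕ → ℝ → ℝ) (φ : ℕ → ℝ → ℝ → ℝ) (k : ℕ) (t : ℝ) : ℝ :=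
  ∫ q in (Set.Icc (0:ℝ) t) ×ˢ (Set.Icc (0:ℝ) 1),
    (if 0 ≤ q.2 ∧ q.2 < rcoord (fun j => ζ j q.1) k then φ k q.1 q.2 else 0)

def memST (T : ℝ) (p : ℕ → ℝ) (ζ : ℕ → ℝ → ℝ) (ψ : ℝ → ℝ) (φ : ℕ → ℝ → ℝ → ℝ) : Prop :=
  (∀ k, Measurable (fun q : ℝ × ℝ => φ k q.1 q.2)) ∧
  (∀ k s y, 0 ≤ φ k s y) ∧
  (∀ k, IntegrableOn
      (fun q : ℝ × ℝ => if 0 ≤ q.2 ∧ q.2 < rcoord (fun j => ζ j q.1) k then φ k q.1 q.2 else 0)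
      ((Set.Icc (0:ℝ) T) ×ˢ (Set.Icc (0:ℝ) 1))) ∧
  (∀ t ∈ Set.Icc (0:ℝ) T, ψ t = ∑' k : ℕ, ((k : ℝ) - 2) * Bint ζ φ k t) ∧
  (∀ t ∈ Set.Icc (0:ℝ) T, ∀ k : ℕ, 1 ≤ k → ζ k t = p k - Bint ζ φ k t)

noncomputable def costE (T : ℝ) (φ : ℕ → ℝ → ℝ → ℝ) : ℝ≥0∞ :=
  ∑' k : ℕ, ∫⁻ q in (Set.Icc (0:ℝ) T) ×ˢ (Set.Icc (0:ℝ) 1),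
    ENNReal.ofReal (ell (φ k q.1 q.2))

open Classical in
noncomputable def rateI (T : ℝ) (p : ℕ → ℝ) (ζ : ℕ → ℝ → ℝ) (ψ : ℝ → ℝ) : ℝ≥0∞ :=
  if memCT T p ζ ψ then ⨅ (φ : ℕ → ℝ → ℝ → ℝ) (_ : memST T p ζ ψ φ), costE T φ else ⊤

theorem Bint_nonneg {T : ℝ} {p : ℕ → ℝ} {ζ : ℕ → ℝ → ℝ} {ψ : ℝ → ℝ} {φ : ℕ → ℝ → ℝ → ℝ}
    (hST : memST T p ζ ψ φ) (k : ℕ) (t : ℝ) : 0 ≤ Bint ζ φ k t := by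
  refine integral_nonneg fun q => ?_
  dsimp only [Pi.zero_apply]
  split_ifs
  exacts [hST.2.1 k q.1 q.2, le_rfl]

theorem Bint_le {T : ℝ} {p : ℕ → ℝ} {ζ : ℕ → ℝ → ℝ} {ψ : ℝ → ℝ} {φ : ℕ → ℝ → ℝ → ℝ}
    (hCT : memCT T p ζ ψ) (hST : memST T p ζ ψ φ) {k : ℕ} (hk : 1 ≤ k)
    {t : ℝ} (ht : t ∈ Set.Icc (0 : ℝ) T) : Bint ζ φ k t ≤ p k := by
  have hζ := (hCT.2.2.2.2.2 k hk).2.1 t ht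
  rw [hST.2.2.2.2 t ht k hk] at hζ
  linarith

theorem zeta_le {T : ℝ} {p : ℕ → ℝ} {ζ : ℕ → ℝ → ℝ} {ψ : ℝ → ℝ} {φ : ℕ → ℝ → ℝ → ℝ}
    (hST : memST T p ζ ψ φ) {k : ℕ} (hk : 1 ≤ k)
    {t : ℝ} (ht : t ∈ Set.Icc (0 : ℝ) T) : ζ k t ≤ p k := by
  rw [hST.2.2.2.2 t ht k hk]
  linarith [Bint_nonneg hST k t]

theorem summable_tail {p : ℕ → ℝ} (hp : Summable fun k : ℕ => (k : ℝ) * p k) (K : ℕ) :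
    Summable fun j : ℕ => ((K + j : ℕ) : ℝ) * p (K + j) :=
  hp.comp_injective (add_right_injective K)

/-- Both the summability and the bound for a tail of a first moment, by comparison. -/
theorem summable_and_tsum_tail_le {p f : ℕ → ℝ} (hp : Summable fun k : ℕ => (k : ℝ) * p k)
    {K : ℕ} (hf : ∀ j, 0 ≤ f (K + j)) (hfp : ∀ j, f (K + j) ≤ p (K + j)) :
    (Summable fun j : ℕ => ((K + j : ℕ) : ℝ) * f (K + j)) ∧
      ∑' j : ℕ, ((K + j : ℕ) : ℝ) * f (K + j) ≤ ∑' j : ℕ, ((K + j : ℕ) : ℝ) * p (K + j) := by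
  have hle (j : ℕ) : ((K + j : ℕ) : ℝ) * f (K + j) ≤ ((K + j : ℕ) : ℝ) * p (K + j) :=
    mul_le_mul_of_nonneg_left (hfp j) (Nat.cast_nonneg _)
  have hs : Summable fun j : ℕ => ((K + j : ℕ) : ℝ) * f (K + j) :=
    (summable_tail hp K).of_nonneg_of_le (fun j => mul_nonneg (Nat.cast_nonneg _) (hf j)) hle
  exact ⟨hs, hs.tsum_le_tsum hle (summable_tail hp K)⟩

/-- Uniform tail bounds: for controls `φⁿ ∈ S_T(ζⁿ, ψⁿ)`, the tail quantities
`U_K`, `sup_n ∑_{k≥K} k ‖Bⁿ_k‖_∞` and `sup_n ∑_{k≥K} k ‖ζⁿ_k‖_∞` are all bounded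
by `∑_{k≥K} k p_k`, which tends to `0` as `K → ∞`.  (Note
`∫ k φⁿ_k 1_{[0,r_k)} ds dy = k · Bⁿ_k(T)`.) -/
theorem tail_uniform_integrability (T : ℝ) (hT : 0 < T)
    (p : ℕ → ℝ) (hp0 : p 0 = 0) (hpnn : ∀ k, 0 ≤ p k) (hp1 : ∑' k : ℕ, p k = 1)
    (hμsum : Summable fun k : ℕ => (k : ℝ) * p k)
    (ζ : ℕ → ℕ → ℝ → ℝ) (ψ : ℕ → ℝ → ℝ) (φ : ℕ → ℕ → ℝ → ℝ → ℝ)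
    (hCT : ∀ n, memCT T p (ζ n) (ψ n))
    (hST : ∀ n, memST T p (ζ n) (ψ n) (φ n)) :
    (∀ K : ℕ, 1 ≤ K → ∀ n : ℕ,
      (∑' j : ℕ, ((K + j : ℕ) : ℝ) * Bint (ζ n) (φ n) (K + j) T
          ≤ ∑' j : ℕ, ((K + j : ℕ) : ℝ) * p (K + j)) ∧
      (∑' j : ℕ, ((K + j : ℕ) : ℝ) * (⨆ t ∈ Set.Icc (0 : ℝ) T, |Bint (ζ n) (φ n) (K + j) t|)
          ≤ ∑' j : ℕ, ((K + j : ℕ) : ℝ) * p (K + j)) ∧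
      (∑' j : ℕ, ((K + j : ℕ) : ℝ) * (⨆ t ∈ Set.Icc (0 : ℝ) T, ζ n (K + j) t)
          ≤ ∑' j : ℕ, ((K + j : ℕ) : ℝ) * p (K + j))) ∧
    Tendsto (fun K : ℕ => ∑' j : ℕ, ((K + j : ℕ) : ℝ) * p (K + j)) atTop (𝓝 0) := by
  refine ⟨fun K hK n => ?_, ?_⟩
  · have hk (j : ℕ) : 1 ≤ K + j := hK.trans (Nat.le_add_right K j)
    have hT' : T ∈ Set.Icc (0 : ℝ) T := ⟨hT.le, le_rfl⟩
    refine ⟨(summable_and_tsum_tail_le (f := fun k => Bint (ζ n) (φ n) k T) hμsum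
        (fun j => Bint_nonneg (hST n) _ _)
        (fun j => Bint_le (hCT n) (hST n) (hk j) hT')).2,
      (summable_and_tsum_tail_le
        (f := fun k => ⨆ t ∈ Set.Icc (0 : ℝ) T, |Bint (ζ n) (φ n) k t|) hμsum
        (fun j => Real.iSup_nonneg fun t => Real.iSup_nonneg fun _ => abs_nonneg _)
        (fun j => Real.iSup_le (fun t => Real.iSup_le (fun ht => ?_) (hpnn _)) (hpnn _))).2,
      (summable_and_tsum_tail_le
        (f := fun k => ⨆ t ∈ Set.Icc (0 : ℝ) T, ζ n k t) hμsum
        (fun j => Real.iSup_nonneg fun t => Real.iSup_nonneg fun ht =>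
          ((hCT n).2.2.2.2.2 _ (hk j)).2.1 t ht)
        (fun j => Real.iSup_le (fun t => Real.iSup_le
          (fun ht => zeta_le (hST n) (hk j) ht) (hpnn _)) (hpnn _))).2⟩
    rw [abs_of_nonneg (Bint_nonneg (hST n) _ _)]
    exact Bint_le (hCT n) (hST n) (hk j) ht
  · simpa only [add_comm] using tendsto_sum_nat_add fun k : ℕ => (k : ℝ) * p k
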